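/- arXiv:2304.01953 — 4 statements merged into one kernel-verified Lean document; each statement's English description precedes it below -/
import Mathlib

section
/- Let W : Ω → α be a random variable (the vector of counterfactual variables appearing in a valid single-world object), let R' : Ω → ρ be a random variable (the vector of missingness indicators indexing those counterfactuals), let r' ∈ ρ be a value with P(R' = r') > 0, and let V : Ω → α be any random variable satisfying V(ω) = W(ω) for every ω in the event {R' = r'} (the observed-data representation of W on the missingness pattern r', guaranteed by missing-data consistency). If W and R' are independent (the MCAR condition of Theorem 3), then for every w ∈ α, P(W = w) = P(V = w | R' = r'). Hence the law of the single-world counterfactual vector is a functional of the observed data law. -/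
open scoped BigOperators

/-- Probability of the event `A` under the (finitely supported) law `P`. -/
noncomputable def Pr {Ω : Type*} [Fintype Ω] (P : Ω → ℝ) (A : Set Ω) : ℝ :=
  ∑ ω, A.indicator P ω

/-- Conditional probability `P(A | B) = P(A ∩ B) / P(B)`. -/
noncomputable def cPr {Ω : Type*} [Fintype Ω] (P : Ω → ℝ) (A B : Set Ω) : ℝ :=
  Pr P (A ∩ B) / Pr P B

/-- MCAR identification of a single-world object (Theorem 3, case (1)):
if `W ⊥ R'` and `V = W` on `{R' = r'}`, then `P(W = w) = P(V = w | R' = r')`. -/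
theorem stmt_0 {Ω α ρ : Type*} [Fintype Ω] [Fintype α] [Fintype ρ]
    [Nonempty α] [Nonempty ρ]
    (P : Ω → ℝ) (hP : ∀ ω, 0 ≤ P ω) (hPsum : ∑ ω, P ω = 1)
    (W V : Ω → α) (R' : Ω → ρ) (r' : ρ)
    (hpos : 0 < Pr P {ω | R' ω = r'})
    (hcons : ∀ ω, R' ω = r' → V ω = W ω)
    (hindep : ∀ (w : α) (r : ρ),
      Pr P {ω | W ω = w ∧ R' ω = r} = Pr P {ω | W ω = w} * Pr P {ω | R' ω = r}) :
    ∀ w : α, Pr P {ω | W ω = w} = cPr P {ω | V ω = w} {ω | R' ω = r'} := by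
  intro w
  have h_inter : {ω | V ω = w} ∩ {ω | R' ω = r'} = {ω | W ω = w ∧ R' ω = r'} := by
    ext ω
    simp only [Set.mem_inter_iff, Set.mem_ofPred_eq]
    exact and_congr_left fun hr => by rw [hcons ω hr]
  rw [cPr, h_inter, hindep, mul_div_cancel_right₀ _ hpos.ne']
end

section
/- Let W : Ω → α be a random variable (the vector of counterfactual variables appearing in a valid single-world object), let R' : Ω → ρ be a random variable (the vector of missingness indicators indexing those counterfactuals), let O : Ω → β be a random variable (the always-observed covariates), let r' ∈ ρ be a value with P(R' = r', O = o) > 0 for every o with P(O = o) > 0, and let V : Ω → α be any random variable satisfying V(ω) = W(ω) for every ω in the event {R' = r'} (the observed-data representation of W on the missingness pattern r', guaranteed by missing-data consistency). If W ⊥ R' | O (the MAR condition of Theorem 3), then for every w ∈ α, P(W = w) = Σ_{o : P(O=o) > 0} P(V = w | O = o, R' = r') · P(O = o). Hence the law of the single-world counterfactual vector is a functional of the observed data law. -/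
open scoped BigOperators Classical

theorem Pr_nonneg {Ω : Type*} [Fintype Ω] {P : Ω → ℝ} (hP : ∀ ω, 0 ≤ P ω) (A : Set Ω) :
    0 ≤ Pr P A :=
  Finset.sum_nonneg fun ω _ => Set.indicator_nonneg (fun ω _ => hP ω) ω

theorem Pr_mono {Ω : Type*} [Fintype Ω] {P : Ω → ℝ} (hP : ∀ ω, 0 ≤ P ω) {A B : Set Ω}
    (h : A ⊆ B) : Pr P A ≤ Pr P B :=
  Finset.sum_le_sum fun ω _ => Set.indicator_le_indicator_of_subset h hP ω

/-- Law of total probability over the values of a finite-valued random variable. -/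
theorem Pr_eq_sum_inter_fiber {Ω β : Type*} [Fintype Ω] [Fintype β] (P : Ω → ℝ) (O : Ω → β)
    (A : Set Ω) : Pr P A = ∑ o, Pr P (A ∩ {ω | O ω = o}) := by
  unfold Pr
  rw [Finset.sum_comm]
  refine Finset.sum_congr rfl fun ω _ => ?_
  simp [Set.indicator_apply, Set.mem_inter_iff, ite_and]

/-- Null fibers contribute nothing to the law of total probability. -/
theorem Pr_eq_sum_cPr_mul {Ω β : Type*} [Fintype Ω] [Fintype β] {P : Ω → ℝ}
    (hP : ∀ ω, 0 ≤ P ω) (O : Ω → β) (A : Set Ω) :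
    Pr P A = ∑ o ∈ Finset.univ.filter (fun o : β => 0 < Pr P {ω | O ω = o}),
      cPr P A {ω | O ω = o} * Pr P {ω | O ω = o} := by
  rw [Pr_eq_sum_inter_fiber P O, Finset.sum_filter]
  refine Finset.sum_congr rfl fun o _ => ?_
  split_ifs with ho
  · rw [cPr, div_mul_cancel₀ _ ho.ne']
  · exact le_antisymm ((Pr_mono hP Set.inter_subset_right).trans (not_lt.mp ho))
      (Pr_nonneg hP _)

/-- MAR identification of a single-world object (Theorem 3, case (2)):
if `W ⊥ R' | O` and `V = W` on `{R' = r'}`, then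
`P(W = w) = Σ_{o : P(O=o)>0} P(V = w | O = o, R' = r') · P(O = o)`. -/
theorem stmt_1 {Ω α β ρ : Type*} [Fintype Ω] [Fintype α] [Fintype β] [Fintype ρ]
    [Nonempty α] [Nonempty β] [Nonempty ρ]
    (P : Ω → ℝ) (hP : ∀ ω, 0 ≤ P ω) (hPsum : ∑ ω, P ω = 1)
    (W V : Ω → α) (R' : Ω → ρ) (O : Ω → β) (r' : ρ)
    (hpos : ∀ o : β, 0 < Pr P {ω | O ω = o} →
      0 < Pr P {ω | R' ω = r' ∧ O ω = o})
    (hcons : ∀ ω, R' ω = r' → V ω = W ω)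
    (hCI : ∀ o : β, 0 < Pr P {ω | O ω = o} → ∀ (w : α) (r : ρ),
      cPr P {ω | W ω = w ∧ R' ω = r} {ω | O ω = o}
        = cPr P {ω | W ω = w} {ω | O ω = o} * cPr P {ω | R' ω = r} {ω | O ω = o}) :
    ∀ w : α, Pr P {ω | W ω = w}
      = ∑ o ∈ Finset.univ.filter (fun o : β => 0 < Pr P {ω | O ω = o}),
          cPr P {ω | V ω = w} {ω | O ω = o ∧ R' ω = r'} * Pr P {ω | O ω = o} := by
  intro w
  rw [Pr_eq_sum_cPr_mul hP O]
  refine Finset.sum_congr rfl fun o ho => ?_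
  have ho : 0 < Pr P {ω | O ω = o} := (Finset.mem_filter.mp ho).2
  have hr := hpos o ho
  have hci := hCI o ho w r'
  have hnum : {ω | V ω = w} ∩ {ω | O ω = o ∧ R' ω = r'}
      = {ω | W ω = w ∧ R' ω = r'} ∩ {ω | O ω = o} := by
    ext ω
    have := hcons ω
    simp only [Set.mem_inter_iff, Set.mem_ofPred_eq]
    grind
  have hden : {ω | O ω = o ∧ R' ω = r'} = {ω | R' ω = r' ∧ O ω = o} := by
    ext ω
    exact and_comm
  have hinter : {ω | R' ω = r'} ∩ {ω | O ω = o} = {ω | R' ω = r' ∧ O ω = o} := rfl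
  congr 1
  simp only [cPr, hnum, hinter] at hci ⊢
  rw [hden]
  field_simp at hci ⊢
  linarith
end

section
/- Let W : Ω → α, R' : Ω → ρ, O : Ω → β be random variables, let r' ∈ ρ satisfy P(R' = r', O = o) > 0 for every o with P(O = o) > 0, assume W ⊥ R' | O, and let V : Ω → α be any random variable satisfying V(ω) = W(ω) for every ω in the event {R' = r'}. Then for every value w ∈ α, every r ∈ ρ, and every o with P(O = o) > 0: P(W = w, R' = r, O = o) = [P(V = w, R' = r', O = o) / P(R' = r' | O = o)] · P(R' = r | O = o). In particular the joint law of (W, R', O) is expressed as the complete-pattern observed joint rescaled by the propensity P(R' = r' | O = o) times the observed missingness law P(R' = r | O = o) (the identifying functional displayed in Theorem 3). -/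
open scoped BigOperators

/-- The chain rule `P(A ∩ B) = P(A | B) · P(B)`. -/
theorem Pr_inter_eq_cPr_mul {Ω : Type*} [Fintype Ω] (P : Ω → ℝ) (A : Set Ω) {B : Set Ω}
    (hB : Pr P B ≠ 0) : Pr P (A ∩ B) = cPr P A B * Pr P B :=
  (div_mul_cancel₀ _ hB).symm

/-- The identifying functional of Theorem 3: under MAR (`W ⊥ R' | O`) and positivity
of the pattern `r'` within every stratum of `O`, the joint law of `(W, R', O)` equals
the complete-pattern observed joint rescaled by the propensity `P(R' = r' | O = o)`
times the observed missingness law `P(R' = r | O = o)`. -/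
theorem stmt_2 {Ω α β ρ : Type*} [Fintype Ω] [Fintype α] [Fintype β] [Fintype ρ]
    [Nonempty α] [Nonempty β] [Nonempty ρ]
    (P : Ω → ℝ) (hP : ∀ ω, 0 ≤ P ω) (hPsum : ∑ ω, P ω = 1)
    (W V : Ω → α) (R' : Ω → ρ) (O : Ω → β) (r' : ρ)
    (hpos : ∀ o : β, 0 < Pr P {ω | O ω = o} →
      0 < Pr P {ω | R' ω = r' ∧ O ω = o})
    (hCI : ∀ o : β, 0 < Pr P {ω | O ω = o} → ∀ (w : α) (r : ρ),
      cPr P {ω | W ω = w ∧ R' ω = r} {ω | O ω = o}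
        = cPr P {ω | W ω = w} {ω | O ω = o} * cPr P {ω | R' ω = r} {ω | O ω = o})
    (hcons : ∀ ω, R' ω = r' → V ω = W ω) :
    ∀ (w : α) (r : ρ) (o : β), 0 < Pr P {ω | O ω = o} →
      Pr P {ω | W ω = w ∧ R' ω = r ∧ O ω = o}
        = Pr P {ω | V ω = w ∧ R' ω = r' ∧ O ω = o}
            / cPr P {ω | R' ω = r'} {ω | O ω = o}
          * cPr P {ω | R' ω = r} {ω | O ω = o} := by
  intro w r o ho
  have joint : ∀ r, Pr P {ω | W ω = w ∧ R' ω = r ∧ O ω = o}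
      = cPr P {ω | W ω = w} {ω | O ω = o} * cPr P {ω | R' ω = r} {ω | O ω = o}
        * Pr P {ω | O ω = o} := by
    intro r
    rw [← hCI o ho, ← Pr_inter_eq_cPr_mul P _ ho.ne']
    congr 1
    ext ω
    simp [and_assoc]
  have hV : {ω | V ω = w ∧ R' ω = r' ∧ O ω = o} = {ω | W ω = w ∧ R' ω = r' ∧ O ω = o} := by
    ext ω
    simp only [Set.mem_ofPred_eq]
    exact and_congr_left fun h => by rw [hcons ω h.1]
  have hprop : cPr P {ω | R' ω = r'} {ω | O ω = o} ≠ 0 :=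
    (div_pos (hpos o ho) ho).ne'
  rw [hV, joint r, joint r']
  field_simp
end

section
/- Non-identification under an e-colluder (completeness of Theorem 4, Figure 7(d)–(f)). There exist two distinct strictly positive probability mass functions p ≠ q on Bool³, viewed as joint laws of (Z, R₁, R₃) where Z plays the role of the counterfactual Z₂^{(1, r₁ = 1)}, such that: (i) under both p and q, Z and R₁ are independent (so both lie in the e-colluder model in which R₃ may depend arbitrarily on (R₁, Z) while Z ⊥ R₁); (ii) p and q induce the same joint law of (R₁, R₃); and (iii) p(Z = z, R₁ = 1, R₃ = r₃) = q(Z = z, R₁ = 1, R₃ = r₃) for all z, r₃. Since the observed data law constrains the full observability law only through the quantities in (ii) and (iii), the full observability law is not identified in the presence of the e-colluder Z₂^{(1, r₁=1)} → R₃ ← R₁. -/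
open scoped BigOperators

/-- Non-identification under the e-colluder `Z₂^{(1,r₁=1)} → R₃ ← R₁`
(completeness of Theorem 4, Figure 7(d)–(f)): there exist two distinct strictly
positive joint laws of `(Z, R₁, R₃)`, both satisfying `Z ⊥ R₁`, that agree on the
law of `(R₁, R₃)` and on the joint law restricted to `{R₁ = 1}` — i.e. on everything
the observed data law reveals — yet differ as full observability laws. -/
theorem stmt_12 :
    ∃ p q : Bool × Bool × Bool → ℝ,
      (∀ x, 0 < p x) ∧ (∀ x, 0 < q x) ∧
      (∑ x, p x = 1) ∧ (∑ x, q x = 1) ∧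
      p ≠ q ∧
      -- (i) Z ⊥ R₁ under p and under q
      (∀ z b : Bool,
        (∑ r₃ : Bool, p (z, b, r₃))
          = (∑ b' : Bool, ∑ r₃ : Bool, p (z, b', r₃))
            * (∑ z' : Bool, ∑ r₃ : Bool, p (z', b, r₃))) ∧
      (∀ z b : Bool,
        (∑ r₃ : Bool, q (z, b, r₃))
          = (∑ b' : Bool, ∑ r₃ : Bool, q (z, b', r₃))
            * (∑ z' : Bool, ∑ r₃ : Bool, q (z', b, r₃))) ∧
      -- (ii) same joint law of (R₁, R₃)
      (∀ b r₃ : Bool, (∑ z : Bool, p (z, b, r₃)) = ∑ z : Bool, q (z, b, r₃)) ∧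
      -- (iii) same law on the complete-case event {R₁ = 1}
      (∀ z r₃ : Bool, p (z, true, r₃) = q (z, true, r₃)) := by
  refine ⟨fun _ => 1 / 8,
    fun x => if x.2.1 then 1 / 8 else if x.1 = x.2.2 then 3 / 16 else 1 / 16,
    fun _ => by norm_num, fun x => by dsimp only; split_ifs <;> norm_num, ?_, ?_, fun h => ?_,
    ?_, ?_, ?_, ?_⟩
  · norm_num [Fintype.sum_prod_type]
  · norm_num [Fintype.sum_prod_type]
  · have := congrFun h (true, false, true)
    norm_num at this
  · norm_num
  · rintro (_ | _) (_ | _) <;> norm_num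
  · rintro (_ | _) (_ | _) <;> norm_num
  · simp
end
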